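/- arXiv:1902.00022 — 2 statements merged into one kernel-verified Lean document; each statement's English description precedes it below -/
import Mathlib

section
/- Let n = 3r, let (C, C̄) be an equitable partition of Q_n with quotient matrix [[0,3r],[r,2r]], and let v ∈ F_2^n be a vector of weight 2r such that ⟨c, v⟩ = 0 for every c ∈ C. Define C' = {x ∈ F_2^n : ⟨x, v⟩ = 0} \ C and C'' = {x ∈ F_2^n : ⟨x, v⟩ = 1}. Then (C, C', C'') is an equitable partition of Q_n with quotient matrix [[0, r, 2r], [r, 0, 2r], [r, r, r]]. -/
/-- Binary words of length `n`: the vertex set of the hypercube `Q_n`. -/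
abbrev BW (n : ℕ) := Fin n → ZMod 2

/-- Adjacency in a Hamming-type graph (hypercube `Q_n`, Hamming graph `H(r,q)`, ...):
two words are adjacent iff they differ in exactly one coordinate. -/
def hAdj {ι : Type*} {β : ι → Type*} [Fintype ι] [∀ i, DecidableEq (β i)]
    (x y : ∀ i, β i) : Prop :=
  hammingDist x y = 1

/-- `(Cs i)_{i < k}` is an equitable partition of the graph with vertex set `V` and
adjacency relation `adj`, with quotient matrix `S`: the cells are nonempty, every vertex
lies in exactly one cell, and every vertex of `Cs i` has exactly `S i j` neighbors in `Cs j`. -/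
def IsEquitablePartition {V : Type*} (adj : V → V → Prop) {k : ℕ}
    (Cs : Fin k → Set V) (S : Fin k → Fin k → ℕ) : Prop :=
  (∀ i, (Cs i).Nonempty) ∧
  (∀ v : V, ∃! i, v ∈ Cs i) ∧
  ∀ i j : Fin k, ∀ v ∈ Cs i, {w | w ∈ Cs j ∧ adj v w}.ncard = S i j

theorem hAdj_iff_aux {n : ℕ} (x y : BW n) :
    hAdj x y ↔ ∃ i, y = x + Pi.single i 1 := by
  unfold hAdj hammingDist
  rw [Finset.card_eq_one]
  constructor
  · rintro ⟨i, hi⟩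
    refine ⟨i, ?_⟩
    ext j
    have hj : j ∈ ({k | x k ≠ y k} : Finset (Fin n)) ↔ j ∈ ({i} : Finset (Fin n)) := by rw [hi]
    simp only [Finset.mem_filter, Finset.mem_univ, true_and, Finset.mem_singleton] at hj
    by_cases h : j = i
    · subst h
      have h1 := hj.2 rfl
      simp only [Pi.add_apply, Pi.single_eq_same]
      generalize x j = a at *
      generalize y j = b at *
      clear hj hi
      revert a b
      decide
    · have : x j = y j := by
        by_contra h2
        exact h (hj.1 h2)
      simp [h, this]
  · rintro ⟨i, rfl⟩
    refine ⟨i, ?_⟩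
    ext j
    by_cases h : j = i
    · subst h; simp
    · simp [h]

theorem ncard_nbr_aux {n : ℕ} (x : BW n) (P : Set (BW n)) :
    {w | w ∈ P ∧ hAdj x w}.ncard = {i : Fin n | x + Pi.single i 1 ∈ P}.ncard := by
  have : {w | w ∈ P ∧ hAdj x w} =
      (fun i : Fin n => x + Pi.single i 1) '' {i : Fin n | x + Pi.single i 1 ∈ P} := by
    ext w
    simp only [Set.mem_setOf_eq, Set.mem_image, hAdj_iff_aux]
    constructor
    · rintro ⟨h, i, rfl⟩
      exact ⟨i, h, rfl⟩
    · rintro ⟨i, h, rfl⟩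
      exact ⟨h, i, rfl⟩
  rw [this, Set.ncard_image_of_injective]
  intro i j hij
  have h1 : (Pi.single i 1 : BW n) = Pi.single j 1 := add_left_cancel hij
  by_contra hne
  have := congrFun h1 i
  simp [hne] at this

theorem inner_aux {n : ℕ} (x v : BW n) (i : Fin n) :
    ∑ j, (x + Pi.single i 1 : BW n) j * v j = ∑ j, x j * v j + v i := by
  simp [add_mul, Finset.sum_add_distrib, Pi.single_apply]

theorem zmod2_aux (a : ZMod 2) : a = 0 ∨ a = 1 := by
  revert a; decide

theorem stmt_10 (n r : ℕ) (hn : n = 3 * r) (C : Set (BW n))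
    (hC : IsEquitablePartition hAdj ![C, Cᶜ] ![![0, 3*r], ![r, 2*r]])
    (v : BW n) (hwt : hammingNorm v = 2 * r)
    (hv : ∀ c ∈ C, ∑ i, c i * v i = 0) :
    IsEquitablePartition hAdj
      ![C, {x : BW n | ∑ i, x i * v i = 0} \ C, {x : BW n | ∑ i, x i * v i = 1}]
      ![![0, r, 2*r], ![r, 0, 2*r], ![r, r, r]] := by
  obtain ⟨hne, -, hcnt⟩ := hC
  have hC0 : ∀ x ∈ C, {i : Fin n | x + Pi.single i 1 ∈ C}.ncard = 0 := by
    intro x hx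
    rw [← ncard_nbr_aux]
    exact hcnt 0 0 x hx
  have hC1 : ∀ x ∉ C, {i : Fin n | x + Pi.single i 1 ∈ C}.ncard = r := by
    intro x hx
    rw [← ncard_nbr_aux]
    exact hcnt 1 0 x hx
  have hV1 : {i : Fin n | v i = 1}.ncard = 2 * r := by
    rw [← hwt, hammingNorm, ← Set.ncard_coe_finset]
    congr 1
    ext i
    have : v i = 1 ↔ v i ≠ 0 := by
      generalize v i = a
      revert a; decide
    simp [this]
  have hV0 : {i : Fin n | v i = 0}.ncard = r := by
    have h := Set.ncard_add_ncard_compl {i : Fin n | v i = 1}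
    have h2 : {i : Fin n | v i = 1}ᶜ = {i : Fin n | v i = 0} := by
      ext i
      simp only [Set.mem_compl_iff, Set.mem_setOf_eq]
      generalize v i = a
      revert a; decide
    rw [h2, hV1, Nat.card_eq_fintype_card, Fintype.card_fin] at h
    omega
  have hr : 0 < r := by
    rcases Nat.eq_zero_or_pos r with h | h
    · exfalso
      subst h
      subst hn
      obtain ⟨a, ha⟩ := hne 0
      obtain ⟨b, hb⟩ := hne 1
      have : a = b := by
        ext i
        exact i.elim0
      subst this
      exact hb ha
    · exact h
  have hdiff : ∀ x : BW n, ∀ a : ZMod 2, ∑ i, x i * v i = a →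
      {i : Fin n | x + Pi.single i 1 ∈ {x : BW n | ∑ i, x i * v i = 0} \ C}.ncard
        = {i : Fin n | v i = a}.ncard - {i : Fin n | x + Pi.single i 1 ∈ C}.ncard := by
    intro x a hx
    rw [← Set.ncard_diff]
    · congr 1
      ext i
      simp only [Set.mem_setOf_eq, Set.mem_diff, inner_aux, hx]
      have : a + v i = 0 ↔ v i = a := by
        generalize v i = b
        clear hx
        revert a b; decide
      rw [this]
    · intro i hi
      have h := hv _ hi
      rw [inner_aux, hx] at h
      simp only [Set.mem_setOf_eq]
      generalize v i = b at *
      clear hx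
      revert a b; decide
  have hodd : ∀ x : BW n, ∀ a : ZMod 2, ∑ i, x i * v i = a →
      {i : Fin n | x + Pi.single i 1 ∈ {x : BW n | ∑ i, x i * v i = 1}}.ncard
        = {i : Fin n | v i = a + 1}.ncard := by
    intro x a hx
    congr 1
    ext i
    simp only [Set.mem_setOf_eq, inner_aux, hx]
    generalize v i = b
    clear hx
    revert a b; decide
  have h11 : (1 + 1 : ZMod 2) = 0 := by decide
  have hnot : ∀ x : BW n, ∑ i, x i * v i = 1 → x ∉ C := by
    intro x hx hxC
    rw [hv x hxC] at hx
    exact absurd hx (by decide)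
  refine ⟨?_, ?_, ?_⟩
  · obtain ⟨c, hc⟩ := hne 0
    have hc : c ∈ C := hc
    have h1 := hdiff c 0 (hv c hc)
    rw [hC0 c hc, hV0] at h1
    have h2 := hodd c 0 (hv c hc)
    rw [zero_add, hV1] at h2
    intro i
    fin_cases i
    · exact ⟨c, hc⟩
    · obtain ⟨i, hi⟩ := Set.nonempty_of_ncard_ne_zero
        (s := {i : Fin n | c + Pi.single i 1 ∈ {x : BW n | ∑ i, x i * v i = 0} \ C}) (by omega)
      exact ⟨_, hi⟩
    · obtain ⟨i, hi⟩ := Set.nonempty_of_ncard_ne_zero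
        (s := {i : Fin n | c + Pi.single i 1 ∈ {x : BW n | ∑ i, x i * v i = 1}}) (by omega)
      exact ⟨_, hi⟩
  · intro x
    by_cases hx : x ∈ C
    · refine ⟨0, hx, ?_⟩
      intro j hj
      fin_cases j
      · rfl
      · exact absurd hx hj.2
      · exact absurd hx (hnot x hj)
    · rcases zmod2_aux (∑ i, x i * v i) with h | h
      · refine ⟨1, ⟨h, hx⟩, ?_⟩
        intro j hj
        fin_cases j
        · exact absurd hj hx
        · rfl
        · exact absurd (h.symm.trans hj) (by decide)
      · refine ⟨2, h, ?_⟩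
        intro j hj
        fin_cases j
        · exact absurd hj hx
        · exact absurd (hj.1.symm.trans h) (by decide)
        · rfl
  · intro i j x hx
    rw [ncard_nbr_aux]
    fin_cases i
    · have hx : x ∈ C := hx
      fin_cases j
      · exact hC0 x hx
      · refine (hdiff x 0 (hv x hx)).trans ?_
        rw [hC0 x hx, hV0]; rfl
      · refine (hodd x 0 (hv x hx)).trans ?_
        rw [zero_add, hV1]; rfl
    · have hx0 : ∑ i, x i * v i = 0 := hx.1
      have hxC : x ∉ C := hx.2
      fin_cases j
      · exact hC1 x hxC
      · refine (hdiff x 0 hx0).trans ?_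
        rw [hC1 x hxC, hV0, Nat.sub_self]; rfl
      · refine (hodd x 0 hx0).trans ?_
        rw [zero_add, hV1]; rfl
    · have hx1 : ∑ i, x i * v i = 1 := hx
      have hxC := hnot x hx1
      fin_cases j
      · exact hC1 x hxC
      · refine (hdiff x 1 hx1).trans ?_
        rw [hC1 x hxC, hV1]
        change 2 * r - r = r
        omega
      · refine (hodd x 1 hx1).trans ?_
        rw [h11, hV0]; rfl
end

section
/- Let r ≥ 1 and let n_1, ..., n_r be positive multiples of 3 with N = n_1 + ... + n_r. For each j ∈ {1,...,r}, let (T^{(j)}_0, T^{(j)}_1, T^{(j)}_2, T^{(j)}_3) be an equitable partition of Q_{n_j} with quotient matrix having 0 on the diagonal and n_j/3 in every off-diagonal entry. Let C be an MDS code in H(r,4). Define C' = ∪_{(v_1,...,v_r) ∈ C} T^{(1)}_{v_1} × ... × T^{(r)}_{v_r} ⊆ F_2^N. Then (C', C̄') is an equitable partition of Q_N with quotient matrix [[0, N], [N/3, 2N/3]]. -/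
/-- A Latin `r`-cube of order 4: an equitable partition of the Hamming graph `H(r,4)`
into four cells, with quotient matrix having `0` on the diagonal and `r` off the diagonal. -/
def IsLatinCube (r : ℕ) (Cs : Fin 4 → Set (Fin r → Fin 4)) : Prop :=
  IsEquitablePartition hAdj Cs (fun i j => if i = j then 0 else r)

/-- A (4-ary distance-2) MDS code in `H(r,4)`: `(C, C̄)` is an equitable partition
of `H(r,4)` with quotient matrix `[[0, 3r], [r, 2r]]`. -/
def IsMDS (r : ℕ) (C : Set (Fin r → Fin 4)) : Prop :=
  IsEquitablePartition hAdj ![C, Cᶜ] ![![0, 3*r], ![r, 2*r]]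

/-- The coordinate of `F_2^N` corresponding to position `b` in the `j`-th block,
where the blocks have lengths `n 0, ..., n (r-1)` with `∑ j, n j = N`. -/
def blockCoord {N r : ℕ} {n : Fin r → ℕ} (hN : ∑ j, n j = N)
    (j : Fin r) (b : Fin (n j)) : Fin N :=
  ⟨(∑ i ∈ Finset.univ.filter (fun i => i < j), n i) + b, by
    have hb := b.isLt
    have hnotin : j ∉ Finset.univ.filter (fun i => i < j) := by simp
    have h1 : (∑ i ∈ insert j (Finset.univ.filter (fun i => i < j)), n i) ≤ ∑ i, n i :=
      Finset.sum_le_sum_of_subset (Finset.subset_univ _)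
    rw [Finset.sum_insert hnotin] at h1
    omega⟩

/-- The concatenation `∪_{(v_1,...,v_r) ∈ D} T^{(1)}_{v_1} × ... × T^{(r)}_{v_r} ⊆ F_2^N`,
where the `j`-th block of coordinates has length `n j` and `∑ j, n j = N`. -/
def concatProd {N r : ℕ} {n : Fin r → ℕ} (hN : ∑ j, n j = N)
    (T : ∀ j : Fin r, Fin 4 → Set (Fin (n j) → ZMod 2))
    (D : Set (Fin r → Fin 4)) : Set (BW N) :=
  {x | ∃ v ∈ D, ∀ j : Fin r, (fun b : Fin (n j) => x (blockCoord hN j b)) ∈ T j (v j)}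

theorem hAdj_iff {ι : Type*} {β : ι → Type*} [Fintype ι] [DecidableEq ι]
    [∀ i, DecidableEq (β i)] (x y : ∀ i, β i) :
    hAdj x y ↔ ∃ i, x i ≠ y i ∧ y = Function.update x i (y i) := by
  unfold hAdj hammingDist
  rw [Finset.card_eq_one]
  constructor
  · rintro ⟨i, hi⟩
    have h : ∀ k, x k ≠ y k ↔ k = i := by
      intro k
      have := Finset.ext_iff.mp hi k
      simpa using this
    refine ⟨i, (h i).2 rfl, ?_⟩
    funext k
    by_cases hk : k = i
    · subst hk; simp
    · rw [Function.update_of_ne hk]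
      by_contra hne
      exact hk ((h k).1 (fun e => hne e.symm))
  · rintro ⟨i, hne, hy⟩
    refine ⟨i, ?_⟩
    ext k
    simp only [Finset.mem_filter, Finset.mem_univ, true_and, Finset.mem_singleton]
    constructor
    · intro hk
      by_contra hki
      apply hk
      rw [hy, Function.update_of_ne hki]
    · rintro rfl; exact hne

theorem hAdj_update {ι : Type*} {β : ι → Type*} [Fintype ι] [DecidableEq ι]
    [∀ i, DecidableEq (β i)] (x : ∀ i, β i) (i : ι) (a b : β i) (hab : a ≠ b) :
    hAdj (Function.update x i a) (Function.update x i b) := by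
  rw [hAdj_iff]
  exact ⟨i, by simpa using hab, by simp⟩

/-- flip the coordinate `i` of a binary word -/
def flipW {m : ℕ} (x : Fin m → ZMod 2) (i : Fin m) : Fin m → ZMod 2 :=
  Function.update x i (x i + 1)

theorem zmod2_ne (a b : ZMod 2) : a ≠ b ↔ b = a + 1 := by
  revert a b; decide

theorem flipW_inj {m : ℕ} (x : Fin m → ZMod 2) : Function.Injective (flipW x) := by
  intro i k h
  by_contra hik
  have := congrFun h i
  simp [flipW, Function.update_of_ne hik] at this

open Classical in
theorem ncard_flip {m : ℕ} (x : Fin m → ZMod 2) (S : Set (Fin m → ZMod 2)) :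
    {w | w ∈ S ∧ hAdj x w}.ncard = ∑ i : Fin m, if flipW x i ∈ S then 1 else 0 := by
  have h : {w | w ∈ S ∧ hAdj x w} =
      ((Finset.univ.filter (fun i => flipW x i ∈ S)).image (flipW x) :
        Finset (Fin m → ZMod 2)) := by
    ext w
    simp only [Set.mem_ofPred_eq, Finset.coe_image, Finset.coe_filter, Finset.mem_univ, true_and,
      Set.mem_image, hAdj_iff]
    constructor
    · rintro ⟨hw, i, hne, hy⟩
      have e : flipW x i = w := by
        rw [hy, flipW, (zmod2_ne _ _).1 hne]
      exact ⟨i, e ▸ hw, e⟩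
    · rintro ⟨i, hi, rfl⟩
      refine ⟨hi, i, ?_, ?_⟩ <;> simp [flipW]
  rw [h, Set.ncard_coe_finset, Finset.card_image_of_injective _ (flipW_inj x),
    Finset.card_filter]

theorem blockCoord_inj {N r : ℕ} {n : Fin r → ℕ} (hN : ∑ j, n j = N) :
    Function.Injective (fun p : (Σ j, Fin (n j)) => blockCoord hN p.1 p.2) := by
  have key : ∀ (j k : Fin r) (b : Fin (n j)) (c : Fin (n k)), j < k →
      (blockCoord hN j b).1 < (blockCoord hN k c).1 := by
    intro j k b c hjk
    have hb := b.isLt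
    have hnotin : j ∉ Finset.univ.filter (fun i => i < j) := by simp
    have h1 : (∑ i ∈ insert j (Finset.univ.filter (fun i => i < j)), n i)
        ≤ ∑ i ∈ Finset.univ.filter (fun i => i < k), n i := by
      apply Finset.sum_le_sum_of_subset
      intro i hi
      simp only [Finset.mem_insert, Finset.mem_filter, Finset.mem_univ, true_and] at hi ⊢
      rcases hi with rfl | hi
      · exact hjk
      · exact hi.trans hjk
    rw [Finset.sum_insert hnotin] at h1
    simp only [blockCoord]
    omega
  rintro ⟨j, b⟩ ⟨k, c⟩ h
  simp only at h
  rcases lt_trichotomy j k with hjk | rfl | hjk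
  · have := key j k b c hjk
    rw [h] at this; omega
  · have h' := congrArg Fin.val h
    simp only [blockCoord] at h'
    have : b = c := Fin.ext (by omega)
    rw [this]
  · have := key k j c b hjk
    rw [h] at this; omega

theorem blockCoord_bij {N r : ℕ} {n : Fin r → ℕ} (hN : ∑ j, n j = N) :
    Function.Bijective (fun p : (Σ j, Fin (n j)) => blockCoord hN p.1 p.2) := by
  rw [Fintype.bijective_iff_injective_and_card]
  exact ⟨blockCoord_inj hN, by simp [hN]⟩

theorem mds_unique {r : ℕ} {C : Set (Fin r → Fin 4)} (hC : IsMDS r C)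
    (v : Fin r → Fin 4) (j : Fin r) (a b : Fin 4)
    (ha : Function.update v j a ∈ C) (hb : Function.update v j b ∈ C) : a = b := by
  by_contra hab
  have h := hC.2.2 0 0 (Function.update v j a) ha
  have h0 : {w | w ∈ C ∧ hAdj (Function.update v j a) w}.ncard = 0 := h
  rw [Set.ncard_eq_zero (Set.toFinite _)] at h0
  have : Function.update v j b ∈ {w | w ∈ C ∧ hAdj (Function.update v j a) w} :=
    ⟨hb, hAdj_update v j a b hab⟩
  rw [h0] at this
  exact this

theorem mds_exists {r : ℕ} {C : Set (Fin r → Fin 4)} (hC : IsMDS r C)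
    (v : Fin r → Fin 4) (hv : v ∉ C) (j : Fin r) :
    ∃ a, Function.update v j a ∈ C := by
  have h : {w | w ∈ C ∧ hAdj v w}.ncard = r := hC.2.2 1 0 v hv
  have hc : ∀ w : {w | w ∈ C ∧ hAdj v w}, ∃ i, w.1 = Function.update v i (w.1 i) := by
    rintro ⟨w, hw, had⟩
    obtain ⟨i, -, hi⟩ := (hAdj_iff _ _).1 had
    exact ⟨i, hi⟩
  choose f hf using hc
  have finj : Function.Injective f := by
    intro w w' hww
    have h1 := hf w
    have h2 := hf w'
    rw [← hww] at h2
    have := mds_unique hC v (f w) _ _ (h1 ▸ w.2.1) (h2 ▸ w'.2.1)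
    apply Subtype.ext
    rw [h1, h2, this]
  have hbij : Function.Bijective f := by
    rw [Nat.bijective_iff_injective_and_card]
    refine ⟨finj, ?_⟩
    rw [Nat.card_coe_set_eq, h, Nat.card_fin]
  obtain ⟨w, rfl⟩ := hbij.2 j
  exact ⟨w.1 (f w), (hf w) ▸ w.2.1⟩

theorem stmt_15 (r : ℕ) (hr : 1 ≤ r) (n : Fin r → ℕ)
    (hpos : ∀ j, 0 < n j) (h3 : ∀ j, 3 ∣ n j)
    (N : ℕ) (hN : ∑ j, n j = N)
    (T : ∀ j : Fin r, Fin 4 → Set (Fin (n j) → ZMod 2))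
    (hT : ∀ j, IsEquitablePartition hAdj (T j) (fun a b => if a = b then 0 else n j / 3))
    (C : Set (Fin r → Fin 4)) (hC : IsMDS r C) :
    IsEquitablePartition hAdj ![concatProd hN T C, (concatProd hN T C)ᶜ]
      ![![0, N], ![N/3, 2*N/3]] := by
  classical
  -- cell index of every word of a block
  have hcell : ∀ j, ∀ y : Fin (n j) → ZMod 2, ∃ a, ∀ b, y ∈ T j b ↔ b = a := by
    intro j y
    obtain ⟨a, ha, hu⟩ := (hT j).2.1 y
    exact ⟨a, fun b => ⟨fun hb => hu b hb, fun e => e ▸ ha⟩⟩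
  choose cell hcell using hcell
  let blk : BW N → ∀ j : Fin r, Fin (n j) → ZMod 2 := fun x j b => x (blockCoord hN j b)
  let φ : BW N → Fin r → Fin 4 := fun x j => cell j (blk x j)
  have hmem : ∀ D, ∀ x, x ∈ concatProd hN T D ↔ φ x ∈ D := by
    intro D x
    constructor
    · rintro ⟨v, hv, hx⟩
      have : v = φ x := funext fun j => (hcell j _ _).1 (hx j)
      exact this ▸ hv
    · intro h
      exact ⟨φ x, h, fun j => (hcell j _ _).2 rfl⟩
  have hsurj : ∀ v, ∃ x, φ x = v := by
    intro v
    choose y hy using fun j => (hT j).1 (v j)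
    let e := Equiv.ofBijective _ (blockCoord_bij hN)
    refine ⟨fun i => y (e.symm i).1 (e.symm i).2, ?_⟩
    funext j
    have : blk (fun i => y (e.symm i).1 (e.symm i).2) j = y j := by
      funext b
      have h1 : e.symm (blockCoord hN j b) = ⟨j, b⟩ := by
        rw [Equiv.symm_apply_eq]; rfl
      have h2 : ∀ p : (Σ j, Fin (n j)), p = ⟨j, b⟩ → y p.1 p.2 = y j b := by
        rintro _ rfl; rfl
      exact h2 _ h1
    have h3 : φ (fun i => y (e.symm i).1 (e.symm i).2) j = cell j (y j) := by
      rw [← this]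
    rw [h3]
    exact ((hcell j _ _).1 (hy j)).symm
  have hflip : ∀ x j b, φ (flipW x (blockCoord hN j b)) =
      Function.update (φ x) j (cell j (flipW (blk x j) b)) := by
    intro x j b
    have hb : blk (flipW x (blockCoord hN j b)) = Function.update (blk x) j (flipW (blk x j) b) := by
      funext k c
      by_cases hk : k = j
      · subst hk
        rw [Function.update_self]
        by_cases hc : c = b
        · subst hc; simp [blk, flipW]
        · have : blockCoord hN k c ≠ blockCoord hN k b := by
            intro h
            have := @blockCoord_inj N r n hN ⟨k, c⟩ ⟨k, b⟩ h
            simp at this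
            exact hc this
          simp [blk, flipW, Function.update_of_ne this, Function.update_of_ne hc]
      · have : blockCoord hN k c ≠ blockCoord hN j b := by
          intro h
          have := @blockCoord_inj N r n hN ⟨k, c⟩ ⟨j, b⟩ h
          exact hk (congrArg Sigma.fst this)
        rw [Function.update_of_ne hk]
        simp [blk, flipW, Function.update_of_ne this]
    funext k
    change cell k (blk (flipW x (blockCoord hN j b)) k) = _
    rw [hb]
    by_cases hk : k = j
    · subst hk; simp
    · simp [Function.update_of_ne hk, φ]
  have hsum : ∀ f : Fin N → ℕ, ∑ i, f i = ∑ j, ∑ b : Fin (n j), f (blockCoord hN j b) := by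
    intro f
    rw [← Fintype.sum_sigma' (fun j (b : Fin (n j)) => f (blockCoord hN j b))]
    exact ((blockCoord_bij hN).sum_comp f).symm
  have hcount : ∀ x j a, (∑ b : Fin (n j), if cell j (flipW (blk x j) b) = a then 1 else 0)
      = if φ x j = a then 0 else n j / 3 := by
    intro x j a
    have h := (hT j).2.2 (φ x j) a (blk x j) ((hcell j _ _).2 rfl)
    rw [ncard_flip] at h
    refine Eq.trans ?_ h
    refine Finset.sum_congr rfl fun b _ => ?_
    simp only [hcell, eq_comm]
  have hin : ∀ x, {w | w ∈ concatProd hN T C ∧ hAdj x w}.ncard =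
      if x ∈ concatProd hN T C then 0 else N / 3 := by
    intro x
    rw [ncard_flip, hsum]
    simp only [hmem, hflip]
    split_ifs with hx
    · refine Finset.sum_eq_zero fun j _ => ?_
      have h1 := hcount x j (φ x j)
      rw [if_pos rfl] at h1
      rw [← h1]
      refine Finset.sum_congr rfl fun b _ => ?_
      congr 1
      apply propext
      constructor
      · intro h
        exact mds_unique hC (φ x) j _ _ h (by simpa using hx)
      · intro h
        rw [h]; simpa using hx
    · have hs : N / 3 = ∑ j, n j / 3 := by
        rw [← hN, Nat.sum_div (fun j _ => h3 j)]
      rw [hs]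
      refine Finset.sum_congr rfl fun j _ => ?_
      obtain ⟨a, ha⟩ := mds_exists hC (φ x) hx j
      have h1 := hcount x j a
      rw [if_neg] at h1
      · rw [← h1]
        refine Finset.sum_congr rfl fun b _ => ?_
        congr 1
        apply propext
        constructor
        · intro h
          exact mds_unique hC (φ x) j _ _ h ha
        · intro h
          rw [h]; exact ha
      · rintro rfl
        exact hx (by simpa using ha)
  have hout : ∀ x, {w | w ∈ concatProd hN T C ∧ hAdj x w}.ncard
      + {w | w ∈ (concatProd hN T C)ᶜ ∧ hAdj x w}.ncard = N := by
    intro x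
    rw [ncard_flip, ncard_flip, ← Finset.sum_add_distrib]
    trans ∑ i : Fin N, 1
    · refine Finset.sum_congr rfl fun i _ => ?_
      by_cases h : flipW x i ∈ concatProd hN T C <;> simp [h]
    · simp
  have h3N : 3 ∣ N := hN ▸ Finset.dvd_sum fun j _ => h3 j
  refine ⟨?_, ?_, ?_⟩
  · intro i
    fin_cases i
    · obtain ⟨v, hv⟩ : C.Nonempty := hC.1 0
      obtain ⟨x, rfl⟩ := hsurj v
      exact ⟨x, (hmem C x).2 hv⟩
    · obtain ⟨v, hv⟩ : Cᶜ.Nonempty := hC.1 1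
      obtain ⟨x, rfl⟩ := hsurj v
      exact ⟨x, fun h => hv ((hmem C x).1 h)⟩
  · intro x
    by_cases hx : x ∈ concatProd hN T C
    · refine ⟨0, hx, ?_⟩
      intro i hi
      fin_cases i
      · rfl
      · exact absurd hx hi
    · refine ⟨1, hx, ?_⟩
      intro i hi
      fin_cases i
      · exact absurd hi hx
      · rfl
  · intro i k x hx
    have a1 := hin x
    have a2 := hout x
    fin_cases i
    · have hx' : x ∈ concatProd hN T C := hx
      rw [if_pos hx'] at a1
      fin_cases k
      · exact a1
      · change {w | w ∈ (concatProd hN T C)ᶜ ∧ hAdj x w}.ncard = N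
        omega
    · have hx' : x ∉ concatProd hN T C := hx
      rw [if_neg hx'] at a1
      fin_cases k
      · exact a1
      · change {w | w ∈ (concatProd hN T C)ᶜ ∧ hAdj x w}.ncard = 2 * N / 3
        omega
end
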